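/- Let E be a separable Banach space and (Φ_t)_{t∈ℤ} a stationary ergodic sequence of Lipschitz maps from E to E satisfying: E[log⁺ ‖Φ₀(x) − x‖] < ∞ for some x ∈ E, E[log⁺ Λ(Φ₀)] < ∞, and E[log Λ(Φ₀∘⋯∘Φ₋ᵣ₊₁)] < 0 for some integer r ≥ 1, so that the SRE X_t = Φ_t(X_{t−1}) has a unique stationary ergodic solution (Y_t); assume moreover E[log⁺ ‖Y₀‖] < ∞. Let (Φ̂_t)_{t≥1} be random Lipschitz maps from E to E such that ‖Φ̂_t(x) − Φ_t(x)‖ → 0 e.a.s. for some x ∈ E and Λ(Φ̂_t − Φ_t) → 0 e.a.s. as t → ∞. Then any sequence (Ŷ_t)_{t≥1} with Ŷ_t = Φ̂_t(Ŷ_{t−1}) for t ≥ 1 and arbitrary initial value Ŷ₀ satisfies ‖Ŷ_t − Y_t‖ → 0 exponentially almost surely as t → ∞. -/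

import Mathlib

open MeasureTheory Filter Topology

/-- `log⁺ x = max (log x) 0`. -/
noncomputable def logPlus (x : ℝ) : ℝ := max (Real.log x) 0

/-- The Lipschitz coefficient `Λ(f)` of a map `f`, as the infimum of its Lipschitz
constants. -/
noncomputable def lipCoef {α β : Type*} [PseudoMetricSpace α] [PseudoMetricSpace β]
    (f : α → β) : ℝ :=
  sInf {K : ℝ | 0 ≤ K ∧ LipschitzWith (Real.toNNReal K) f}

/-- The backward composition `Φ_t ∘ Φ_{t-1} ∘ ⋯ ∘ Φ_{t-m}`. -/
def iterComp {Ω E : Type*} (ψ : ℤ → Ω → E → E) (t : ℤ) : ℕ → Ω → E → E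
  | 0 => ψ t
  | m + 1 => fun ω y => iterComp ψ t m ω (ψ (t - (m + 1 : ℕ)) ω y)

/-- Exponentially almost sure convergence to `0`. -/
def EasTendstoZero {Ω : Type*} [MeasurableSpace Ω] (μ : Measure Ω)
    (u : ℕ → Ω → ℝ) : Prop :=
  ∃ C > (0 : ℝ), ∀ᵐ ω ∂μ,
    Tendsto (fun t : ℕ => Real.exp (C * t) * u t ω) atTop (𝓝 0)


/-- running maximum of Birkhoff sums -/
noncomputable def maxB {Ω : Type*} (T : Ω → Ω) (f : Ω → ℝ) : ℕ → Ω → ℝ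
  | 0 => fun _ => 0
  | n + 1 => fun ω => max 0 (f ω + maxB T f n (T ω))

lemma maxB_nonneg {Ω : Type*} (T : Ω → Ω) (f : Ω → ℝ) (n : ℕ) (ω : Ω) : 0 ≤ maxB T f n ω := by
  cases n with
  | zero => exact le_rfl
  | succ n => exact le_max_left _ _

lemma maxB_mono {Ω : Type*} (T : Ω → Ω) (f : Ω → ℝ) (n : ℕ) (ω : Ω) :
    maxB T f n ω ≤ maxB T f (n+1) ω := by
  induction n generalizing ω with
  | zero => exact le_max_left _ _
  | succ n ih => exact max_le_max le_rfl (by linarith [ih (T ω)])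

lemma sum_le_maxB {Ω : Type*} (T : Ω → Ω) (f : Ω → ℝ) (n : ℕ) (ω : Ω) :
    birkhoffSum T f n ω ≤ maxB T f n ω := by
  induction n generalizing ω with
  | zero => simp [maxB]
  | succ n ih =>
    rw [birkhoffSum_succ']
    exact le_trans (by linarith [ih (T ω)]) (le_max_right _ _)

lemma maxB_meas {Ω : Type*} [MeasurableSpace Ω] {T : Ω → Ω} (hT : Measurable T) {f : Ω → ℝ}
    (hf : Measurable f) (n : ℕ) : Measurable (maxB T f n) := by
  induction n with
  | zero => exact measurable_const
  | succ n ih => exact measurable_const.max (hf.add (ih.comp hT))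

lemma maxB_int {Ω : Type*} [MeasurableSpace Ω] {μ : Measure Ω} {T : Ω → Ω}
    (hT : MeasurePreserving T μ μ) {f : Ω → ℝ} (hi : Integrable f μ) (n : ℕ) :
    Integrable (maxB T f n) μ := by
  induction n with
  | zero => exact integrable_zero _ _ _
  | succ n ih =>
    have h2 := hi.add (hT.integrable_comp_of_integrable ih)
    exact (integrable_zero _ _ _).sup h2

lemma birk_upper_meas {Ω : Type*} [MeasurableSpace Ω] {μ : Measure Ω}
    {T : Ω → Ω} (hT : Ergodic T μ) {f : Ω → ℝ} (hf : Measurable f) (hi : Integrable f μ)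
    (hneg : ∫ ω, f ω ∂μ < 0) :
    ∀ᵐ ω ∂μ, ∃ M : ℝ, ∀ n, birkhoffSum T f n ω ≤ M := by
  set s : Set Ω := {ω | BddAbove (Set.range fun n => maxB T f n ω)} with hs
  have hsm : MeasurableSet s :=
    measurableSet_bddAbove_range (fun n => maxB_meas hT.measurable hf n)
  have hinv : T ⁻¹' s = s := by
    ext ω
    simp only [hs, Set.mem_preimage, Set.mem_ofPred_eq]
    constructor
    · rintro ⟨M, hM⟩
      refine ⟨max 0 (f ω + M), ?_⟩
      rintro _ ⟨n, rfl⟩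
      cases n with
      | zero => exact le_max_left _ _
      | succ n =>
        have := hM ⟨n, rfl⟩
        exact max_le_max le_rfl (by simpa using this)
    · rintro ⟨M, hM⟩
      refine ⟨M - f ω, ?_⟩
      rintro _ ⟨n, rfl⟩
      have h1 : maxB T f (n+1) ω ≤ M := hM ⟨n+1, rfl⟩
      have h2 : f ω + maxB T f n (T ω) ≤ maxB T f (n+1) ω := le_max_right _ _
      show maxB T f n (T ω) ≤ _
      linarith
  rcases hT.toPreErgodic.ae_mem_or_ae_notMem hsm hinv with h | h
  · filter_upwards [h] with ω hω
    obtain ⟨M, hM⟩ := hω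
    exact ⟨M, fun n => (sum_le_maxB T f n ω).trans (hM ⟨n, rfl⟩)⟩
  · exfalso
    have hlim : Tendsto (fun n => ∫ ω, max (-(maxB T f n (T ω))) (f ω) ∂μ) atTop
        (𝓝 (∫ ω, f ω ∂μ)) := by
      apply tendsto_integral_of_dominated_convergence (fun ω => |f ω|)
      · intro n
        exact (((maxB_meas hT.measurable hf n).comp hT.measurable).neg.max hf).aestronglyMeasurable
      · exact hi.abs
      · intro n
        refine ae_of_all _ fun ω => ?_
        have h0 := maxB_nonneg T f n (T ω)
        rw [Real.norm_eq_abs, abs_le]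
        refine ⟨(neg_abs_le _).trans (le_max_right _ _), max_le ?_ (le_abs_self _)⟩
        linarith [abs_nonneg (f ω)]
      · filter_upwards [h] with ω hω
        have hω' : T ω ∉ s := by
          intro hc
          exact hω (by rw [← hinv]; exact hc)
        have hmono : Monotone fun n => maxB T f n (T ω) :=
          monotone_nat_of_le_succ fun n => maxB_mono T f n (T ω)
        have htop : Tendsto (fun n => maxB T f n (T ω)) atTop atTop := by
          apply tendsto_atTop_atTop_of_monotone hmono
          intro b
          by_contra! hc
          exact hω' ⟨b, by rintro _ ⟨n, rfl⟩; exact (hc n).le⟩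
        apply tendsto_const_nhds.congr'
        filter_upwards [htop.eventually_ge_atTop (-f ω)] with n hn
        rw [max_eq_right]; linarith
    have hge : ∀ n, 0 ≤ ∫ ω, max (-(maxB T f n (T ω))) (f ω) ∂μ := by
      intro n
      have e : ∀ ω, max (-(maxB T f n (T ω))) (f ω) = maxB T f (n+1) ω - maxB T f n (T ω) := by
        intro ω
        show _ = max 0 (f ω + maxB T f n (T ω)) - _
        rw [← max_sub_sub_right]; simp
      simp_rw [e]
      have hc : Integrable (fun ω => maxB T f n (T ω)) μ :=
        hT.toMeasurePreserving.integrable_comp_of_integrable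
          (maxB_int hT.toMeasurePreserving hi n)
      rw [integral_sub (maxB_int hT.toMeasurePreserving hi (n+1)) hc]
      have hcomp : ∫ ω, maxB T f n (T ω) ∂μ = ∫ ω, maxB T f n ω ∂μ := by
        have h3 := integral_map (μ := μ) (φ := T) hT.measurable.aemeasurable
          (f := maxB T f n) (by
            rw [hT.toMeasurePreserving.map_eq]
            exact (maxB_meas hT.measurable hf n).aestronglyMeasurable)
        rw [hT.toMeasurePreserving.map_eq] at h3
        exact h3.symm
      rw [hcomp]
      have := integral_mono (maxB_int hT.toMeasurePreserving hi n)
        (maxB_int hT.toMeasurePreserving hi (n+1)) (fun ω => maxB_mono T f n ω)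
      linarith
    have := ge_of_tendsto' hlim hge
    linarith

lemma birk_upper {Ω : Type*} [MeasurableSpace Ω] {μ : Measure Ω}
    {T : Ω → Ω} (hT : Ergodic T μ) {f : Ω → ℝ} (hi : Integrable f μ)
    (hneg : ∫ ω, f ω ∂μ < 0) :
    ∀ᵐ ω ∂μ, ∃ M : ℝ, ∀ n, birkhoffSum T f n ω ≤ M := by
  have hae := hi.1.ae_eq_mk
  have h1 := birk_upper_meas hT (f := hi.1.mk f) hi.1.stronglyMeasurable_mk.measurable
    (hi.congr hae) (by rwa [← integral_congr_ae hae])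
  have h2 : ∀ᵐ ω ∂μ, ∀ n, birkhoffSum T f n ω = birkhoffSum T (hi.1.mk f) n ω :=
    ae_all_iff.2 fun n =>
      hT.quasiMeasurePreserving.birkhoffSum_ae_eq_of_ae_eq hae n
  filter_upwards [h1, h2] with ω h h'
  obtain ⟨M, hM⟩ := h
  exact ⟨M, fun n => by rw [h']; exact hM n⟩

lemma birk_bound {Ω : Type*} [MeasurableSpace Ω] {μ : Measure Ω} [IsProbabilityMeasure μ]
    {T : Ω → Ω} (hT : Ergodic T μ) {f : Ω → ℝ} (hi : Integrable f μ) (ε : ℝ) (hε : 0 < ε) :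
    ∀ᵐ ω ∂μ, ∃ M : ℝ, ∀ n : ℕ,
      |(∑ s ∈ Finset.range n, f (T^[s] ω)) - n * ∫ ω, f ω ∂μ| ≤ ε * n + M := by
  set m := ∫ ω, f ω ∂μ with hm
  have h1 := birk_upper hT (f := fun ω => f ω - (m + ε)) (hi.sub (integrable_const _)) (by
    rw [integral_sub hi (integrable_const _)]; simp; linarith)
  have h2 := birk_upper hT (f := fun ω => (m - ε) - f ω) ((integrable_const _).sub hi) (by
    rw [integral_sub (integrable_const _) hi]; simp; linarith)
  filter_upwards [h1, h2] with ω h h'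
  obtain ⟨M, hM⟩ := h
  obtain ⟨M', hM'⟩ := h'
  refine ⟨max M M', fun n => ?_⟩
  have a := hM n
  have b := hM' n
  simp only [birkhoffSum, Finset.sum_sub_distrib, Finset.sum_const, Finset.card_range,
    nsmul_eq_mul] at a b
  rw [abs_le]
  constructor <;> nlinarith [le_max_left M M', le_max_right M M']

lemma growth_bound {Ω : Type*} [MeasurableSpace Ω] {μ : Measure Ω} [IsProbabilityMeasure μ]
    {T : Ω → Ω} (hT : Ergodic T μ) {f : Ω → ℝ} (hi : Integrable f μ) (ε : ℝ) (hε : 0 < ε) :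
    ∀ᵐ ω ∂μ, ∃ M : ℝ, ∀ n : ℕ, f (T^[n] ω) ≤ ε * n + M := by
  filter_upwards [birk_bound hT hi (ε/2) (by positivity)] with ω h
  obtain ⟨M, hM⟩ := h
  refine ⟨2 * M + (∫ ω, f ω ∂μ) + ε, fun n => ?_⟩
  have a := abs_le.1 (hM n)
  have b := abs_le.1 (hM (n+1))
  rw [Finset.sum_range_succ] at b
  push_cast at b
  nlinarith [a.1, a.2, b.1, b.2]

lemma block_bound (L g : ℕ → ℝ) (r N : ℕ) (b : ℝ) (hb : 0 ≤ b)
    (hL : ∀ n, 0 ≤ L n) (h0 : L 0 ≤ 1)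
    (h1 : ∀ n < N, L (n+1) ≤ Real.exp b * L n)
    (h2 : ∀ n, n + r ≤ N → L (n+r) ≤ Real.exp (g (n+r)) * L n) (n : ℕ) (hn : n + r = N) (hr : 1 ≤ r) :
    L N ^ r ≤ Real.exp (2 * r ^ 2 * b + ∑ k ∈ Finset.range n, g (k + r)) := by
  have hstep : ∀ i a, a + i ≤ N → L (a+i) ≤ Real.exp (i * b) * L a := by
    intro i
    induction i with
    | zero => intro a _; simp
    | succ i ih =>
      intro a ha
      have e1 := h1 (a+i) (by omega)
      have e2 := ih a (by omega)
      calc L (a + (i+1)) ≤ Real.exp b * L (a+i) := e1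
        _ ≤ Real.exp b * (Real.exp (i*b) * L a) := by gcongr
        _ = Real.exp ((i+1:ℕ) * b) * L a := by
          rw [← mul_assoc, ← Real.exp_add]; push_cast; ring_nf
  have hV : ∀ m ≤ n, ∏ i ∈ Finset.range r, L (m+i) ≤
      Real.exp (r^2 * b + ∑ k ∈ Finset.range m, g (k + r)) := by
    intro m
    induction m with
    | zero =>
      intro _
      calc ∏ i ∈ Finset.range r, L (0+i) ≤ ∏ i ∈ Finset.range r, Real.exp (r * b) := by
            apply Finset.prod_le_prod (fun i _ => hL _)
            intro i hi
            have hi' := Finset.mem_range.1 hi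
            have := hstep i 0 (by omega)
            calc L (0+i) ≤ Real.exp (i*b) * L 0 := this
              _ ≤ Real.exp (i*b) * 1 := by gcongr
              _ = Real.exp (i*b) := mul_one _
              _ ≤ Real.exp (r*b) := by
                gcongr
        _ = _ := by
          rw [Finset.prod_const, Finset.card_range, ← Real.exp_nat_mul]; simp; ring
    | succ m ih =>
      intro hm
      have e := ih (by omega)
      rw [Finset.sum_range_succ, ← add_assoc, Real.exp_add]
      have hk : ∏ i ∈ Finset.range r, L (m+1+i) ≤
          (∏ i ∈ Finset.range r, L (m+i)) * Real.exp (g (m+r)) := by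
        rcases r with _ | r
        · omega
        · rw [Finset.prod_range_succ, Finset.prod_range_succ']
          have := h2 m (by omega)
          have hp : 0 ≤ ∏ i ∈ Finset.range r, L (m + 1 + i) := Finset.prod_nonneg fun i _ => hL _
          have e3 : ∏ k ∈ Finset.range r, L (m + (k + 1)) = ∏ i ∈ Finset.range r, L (m + 1 + i) :=
            Finset.prod_congr rfl fun i _ => by congr 1; ring
          rw [e3]
          have e4 : L (m + 1 + r) = L (m + (r + 1)) := by congr 1; ring
          rw [e4, add_zero]
          calc _ ≤ (∏ i ∈ Finset.range r, L (m + 1 + i)) *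
              (Real.exp (g (m + (r+1))) * L m) := by gcongr
            _ = _ := by ring
      exact hk.trans (by gcongr)
  calc L N ^ r = ∏ i ∈ Finset.range r, L N := by simp
    _ ≤ ∏ i ∈ Finset.range r, (Real.exp (r * b) * L (n+i)) := by
      apply Finset.prod_le_prod (fun i _ => hL _)
      intro i hi
      have hi' := Finset.mem_range.1 hi
      have := hstep (r - i) (n+i) (by omega)
      have e : n + i + (r - i) = N := by omega
      rw [e] at this
      refine this.trans ?_
      gcongr
      · exact hL _
      · omega
    _ = Real.exp (r^2 * b) * ∏ i ∈ Finset.range r, L (n+i) := by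
      rw [Finset.prod_mul_distrib, Finset.prod_const, Finset.card_range, ← Real.exp_nat_mul]
      congr 2; ring
    _ ≤ Real.exp (r^2 * b) * Real.exp (r^2 * b + ∑ k ∈ Finset.range n, g (k + r)) := by
      gcongr; exact hV n le_rfl
    _ = _ := by rw [← Real.exp_add]; congr 1; ring

lemma sum_gronwall (u b v : ℕ → ℝ) (hv : ∀ n, 0 ≤ v n) (hu : ∀ n, 0 ≤ u n)
    (hb : Monotone b) (h : ∀ n, u n ≤ b n + ∑ j ∈ Finset.range n, v j * u j) (n : ℕ) :
    u n ≤ b n * Real.exp (∑ j ∈ Finset.range n, v j) := by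
  have hb0 : 0 ≤ b n := (hu 0).trans (by have := h 0; simp at this; exact this.trans (hb (Nat.zero_le _)))
  have key : ∀ m ≤ n, b n + ∑ j ∈ Finset.range m, v j * u j ≤
      b n * Real.exp (∑ j ∈ Finset.range m, v j) := by
    intro m
    induction m with
    | zero => simp
    | succ m ih =>
      intro hm
      have e := ih (by omega)
      have e2 : u m ≤ b n + ∑ j ∈ Finset.range m, v j * u j :=
        (h m).trans (by gcongr; exact hb (by omega))
      rw [Finset.sum_range_succ, Finset.sum_range_succ, Real.exp_add]
      have e3 := Real.add_one_le_exp (v m)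
      calc _ = (b n + ∑ j ∈ Finset.range m, v j * u j) + v m * u m := by ring
        _ ≤ (b n + ∑ j ∈ Finset.range m, v j * u j) +
            v m * (b n + ∑ j ∈ Finset.range m, v j * u j) := by
            have := hv m; gcongr
        _ = (b n + ∑ j ∈ Finset.range m, v j * u j) * (v m + 1) := by ring
        _ ≤ (b n * Real.exp (∑ j ∈ Finset.range m, v j)) * Real.exp (v m) := by
            have := hv m
            gcongr
        _ = _ := by ring
  exact (h n).trans (key n le_rfl)

lemma nat_le_exp (ε : ℝ) (hε : 0 < ε) (t : ℕ) : (t : ℝ) ≤ ε⁻¹ * Real.exp (ε * t) := by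
  have := Real.add_one_le_exp (ε * t)
  rw [inv_mul_eq_div, le_div_iff₀ hε]; linarith

lemma step_one (A p w : ℕ → ℝ) (M ε κ : ℝ) (hε : 0 < ε) (hκ : ε < κ) (hM : 0 ≤ M)
    (hA : ∀ n, 0 ≤ A n) (hp : ∀ n, 0 ≤ p n) (hw : ∀ n, 0 ≤ w n)
    (hp' : ∀ n : ℕ, p n ≤ M * Real.exp (ε * n))
    (hw' : ∀ n : ℕ, w n ≤ M * Real.exp (-κ * n))
    (h : ∀ t : ℕ, A t ≤ M * Real.exp (ε * t) *
      (A 0 + ∑ j ∈ Finset.range t, (p j + w j * A j))) :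
    ∃ K, 0 ≤ K ∧ ∀ t : ℕ, A t ≤ K * Real.exp (3 * ε * t) := by
  set q := Real.exp (-(κ - ε)) with hq
  have hq0 : 0 ≤ q := (Real.exp_pos _).le
  have hq1 : q < 1 := by rw [hq, Real.exp_lt_one_iff]; linarith
  set W := M * M * (1 - q)⁻¹ with hW
  have hA0 := hA 0
  have hv : ∀ n : ℕ, M * w n * Real.exp (ε * n) ≤ M * M * q ^ n := by
    intro n
    calc _ ≤ M * (M * Real.exp (-κ * n)) * Real.exp (ε * n) := by gcongr; exact hw' n
      _ = M * M * (Real.exp (-κ * n) * Real.exp (ε * n)) := by ring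
      _ = _ := by rw [← Real.exp_add, hq, ← Real.exp_nat_mul]; ring_nf
  have hsumv : ∀ n : ℕ, ∑ j ∈ Finset.range n, M * w j * Real.exp (ε * j) ≤ W := by
    intro n
    calc _ ≤ ∑ j ∈ Finset.range n, M * M * q ^ j := Finset.sum_le_sum fun j _ => hv j
      _ = M * M * ∑ j ∈ Finset.range n, q ^ j := by rw [Finset.mul_sum]
      _ ≤ M * M * (1 - q)⁻¹ := by
        gcongr
        rw [← tsum_geometric_of_lt_one hq0 hq1]
        exact (summable_geometric_of_lt_one hq0 hq1).sum_le_tsum _ (fun _ _ => by positivity)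
  have hG := sum_gronwall (fun t => Real.exp (-(ε * t)) * A t)
    (fun t => M * (A 0 + ∑ j ∈ Finset.range t, p j)) (fun j => M * w j * Real.exp (ε * j))
    (fun n => mul_nonneg (mul_nonneg hM (hw n)) (Real.exp_pos _).le)
    (fun n => mul_nonneg (Real.exp_pos _).le (hA n))
    (by
      apply monotone_nat_of_le_succ
      intro n
      simp only [Finset.sum_range_succ]
      gcongr
      linarith [hp n])
    (by
      intro t
      have e1 : Real.exp (-(ε * t)) * Real.exp (ε * t) = 1 := by rw [← Real.exp_add]; simp
      calc Real.exp (-(ε * t)) * A t ≤ Real.exp (-(ε * t)) * (M * Real.exp (ε * t) *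
            (A 0 + ∑ j ∈ Finset.range t, (p j + w j * A j))) := by gcongr; exact h t
        _ = (Real.exp (-(ε * t)) * Real.exp (ε * t)) * (M *
            (A 0 + ∑ j ∈ Finset.range t, (p j + w j * A j))) := by ring
        _ = M * (A 0 + ∑ j ∈ Finset.range t, p j) + ∑ j ∈ Finset.range t, M * (w j * A j) := by
            rw [e1, Finset.sum_add_distrib, ← Finset.mul_sum]; ring
        _ = _ := by
            congr 1
            refine Finset.sum_congr rfl fun j _ => ?_
            have e2 : Real.exp (ε * j) * Real.exp (-(ε * j)) = 1 := by
              rw [← Real.exp_add]; simp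
            calc M * (w j * A j) = M * w j * (1 * A j) := by ring
              _ = _ := by rw [← e2]; ring)
  refine ⟨M * (A 0 + M * ε⁻¹) * Real.exp W, by positivity, fun t => ?_⟩
  have hg := hG t
  have hps : ∑ j ∈ Finset.range t, p j ≤ M * ε⁻¹ * Real.exp (2 * ε * t) := by
    calc _ ≤ ∑ j ∈ Finset.range t, M * Real.exp (ε * t) := by
          apply Finset.sum_le_sum
          intro j hj
          refine (hp' j).trans ?_
          have : j ≤ t := (Finset.mem_range.1 hj).le
          gcongr
      _ = t * (M * Real.exp (ε * t)) := by simp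
      _ ≤ (ε⁻¹ * Real.exp (ε * t)) * (M * Real.exp (ε * t)) := by
          gcongr; exact nat_le_exp ε hε t
      _ = M * ε⁻¹ * (Real.exp (ε * t) * Real.exp (ε * t)) := by ring
      _ = _ := by rw [← Real.exp_add]; ring_nf
  have h1e : 1 ≤ Real.exp (2 * ε * t) := Real.one_le_exp (by positivity)
  have hps' : A 0 + ∑ j ∈ Finset.range t, p j ≤ (A 0 + M * ε⁻¹) * Real.exp (2 * ε * t) := by
    nlinarith
  have hps0 : 0 ≤ A 0 + ∑ j ∈ Finset.range t, p j :=
    add_nonneg hA0 (Finset.sum_nonneg fun j _ => hp j)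
  have e1 : Real.exp (ε * t) * Real.exp (-(ε * t)) = 1 := by rw [← Real.exp_add]; simp
  calc A t = Real.exp (ε * t) * (Real.exp (-(ε * t)) * A t) := by rw [← mul_assoc, e1, one_mul]
    _ ≤ Real.exp (ε * t) * (M * (A 0 + ∑ j ∈ Finset.range t, p j) *
        Real.exp (∑ j ∈ Finset.range t, M * w j * Real.exp (ε * j))) := by gcongr
    _ ≤ Real.exp (ε * t) * (M * ((A 0 + M * ε⁻¹) * Real.exp (2 * ε * t)) *
        Real.exp W) := by
        gcongr
        exact hsumv t
    _ = M * (A 0 + M * ε⁻¹) * Real.exp W * (Real.exp (ε * t) * Real.exp (2 * ε * t)) := by ring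
    _ = _ := by rw [← Real.exp_add]; ring_nf

lemma step_two (D q : ℕ → ℝ) (M K ε κ : ℝ) (hε : 0 < ε) (hM : 0 ≤ M) (hK : 0 ≤ K)
    (hD0 : 0 ≤ D 0)
    (hq : ∀ n : ℕ, q n ≤ K * Real.exp (-κ * n + 3 * ε * n))
    (h : ∀ t : ℕ, D t ≤ M * Real.exp (ε * t) *
      (Real.exp (-κ * t) * D 0 +
        ∑ j ∈ Finset.range t, Real.exp (-κ * (t - (j + 1))) * q j)) :
    ∃ K', ∀ t : ℕ, D t ≤ K' * Real.exp (-κ * t + 5 * ε * t) := by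
  refine ⟨M * (D 0 + K * Real.exp κ * ε⁻¹), fun t => (h t).trans ?_⟩
  have hs : ∑ j ∈ Finset.range t, Real.exp (-κ * (t - (j + 1))) * q j ≤
      K * Real.exp κ * ε⁻¹ * Real.exp (-κ * t + 4 * ε * t) := by
    calc _ ≤ ∑ j ∈ Finset.range t, K * Real.exp κ * Real.exp (-κ * t + 3 * ε * t) := by
          apply Finset.sum_le_sum
          intro j hj
          have hj' : (j : ℝ) ≤ t := by exact_mod_cast (Finset.mem_range.1 hj).le
          calc _ ≤ Real.exp (-κ * (t - (j + 1))) * (K * Real.exp (-κ * j + 3 * ε * j)) := by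
                gcongr; exact hq j
            _ = K * (Real.exp (-κ * (t - (j + 1))) * Real.exp (-κ * j + 3 * ε * j)) := by ring
            _ = K * (Real.exp κ * Real.exp (-κ * t + 3 * ε * j)) := by
                rw [← Real.exp_add, ← Real.exp_add]; ring_nf
            _ ≤ K * (Real.exp κ * Real.exp (-κ * t + 3 * ε * t)) := by gcongr
            _ = _ := by ring
      _ = t * (K * Real.exp κ * Real.exp (-κ * t + 3 * ε * t)) := by simp
      _ ≤ (ε⁻¹ * Real.exp (ε * t)) * (K * Real.exp κ * Real.exp (-κ * t + 3 * ε * t)) := by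
          gcongr; exact nat_le_exp ε hε t
      _ = K * Real.exp κ * ε⁻¹ * (Real.exp (ε * t) * Real.exp (-κ * t + 3 * ε * t)) := by ring
      _ = _ := by rw [← Real.exp_add]; ring_nf
  have h0 : Real.exp (-κ * t) ≤ Real.exp (-κ * t + 4 * ε * t) := by
    gcongr; have : 0 ≤ 4 * ε * t := by positivity
    linarith
  calc _ ≤ M * Real.exp (ε * t) * (Real.exp (-κ * t + 4 * ε * t) * D 0 +
        K * Real.exp κ * ε⁻¹ * Real.exp (-κ * t + 4 * ε * t)) := by gcongr
    _ = M * (D 0 + K * Real.exp κ * ε⁻¹) * (Real.exp (ε * t) * Real.exp (-κ * t + 4 * ε * t)) := by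
        ring
    _ = _ := by rw [← Real.exp_add]; ring_nf

lemma lipCoef_nonneg {α β : Type*} [PseudoMetricSpace α] [PseudoMetricSpace β]
    (f : α → β) : 0 ≤ lipCoef f :=
  Real.sInf_nonneg fun _ h => h.1

lemma lipCoef_le {α β : Type*} [PseudoMetricSpace α] [PseudoMetricSpace β]
    {f : α → β} {K : ℝ} (hK : 0 ≤ K) (h : ∀ a b, dist (f a) (f b) ≤ K * dist a b) :
    lipCoef f ≤ K := by
  apply csInf_le ⟨0, fun _ h => h.1⟩
  refine ⟨hK, LipschitzWith.of_dist_le_mul fun a b => ?_⟩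
  rw [Real.coe_toNNReal _ hK]; exact h a b

lemma dist_le_lipCoef {α β : Type*} [PseudoMetricSpace α] [PseudoMetricSpace β]
    {f : α → β} (hf : ∃ K : NNReal, LipschitzWith K f) (a b : α) :
    dist (f a) (f b) ≤ lipCoef f * dist a b := by
  obtain ⟨K, hK⟩ := hf
  rcases (dist_nonneg (x := a) (y := b)).eq_or_lt with h | h
  · have := hK.dist_le_mul a b
    rw [← h] at this ⊢
    simpa using this
  · rw [← div_le_iff₀ h]
    apply le_csInf
    · exact ⟨K, K.2, by simpa using hK⟩
    · rintro K' ⟨h0, h1⟩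
      rw [div_le_iff₀ h]
      have := h1.dist_le_mul a b
      rwa [Real.coe_toNNReal _ h0] at this

lemma lipCoef_comp_le {α β γ : Type*} [PseudoMetricSpace α] [PseudoMetricSpace β]
    [PseudoMetricSpace γ] {f : β → γ} {g : α → β} (hf : ∃ K : NNReal, LipschitzWith K f)
    (hg : ∃ K : NNReal, LipschitzWith K g) :
    lipCoef (fun a => f (g a)) ≤ lipCoef f * lipCoef g := by
  apply lipCoef_le (mul_nonneg (lipCoef_nonneg _) (lipCoef_nonneg _))
  intro a b
  refine (dist_le_lipCoef hf _ _).trans ?_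
  rw [mul_assoc]
  exact mul_le_mul_of_nonneg_left (dist_le_lipCoef hg _ _) (lipCoef_nonneg _)

lemma lipCoef_measurable {Ω E : Type*} [MeasurableSpace Ω] [NormedAddCommGroup E]
    [TopologicalSpace.SeparableSpace E] [MeasurableSpace E] [BorelSpace E]
    (f : Ω → E → E) (hm : ∀ x, Measurable fun ω => f ω x)
    (hf : ∀ ω, ∃ K : NNReal, LipschitzWith K (f ω)) :
    Measurable fun ω => lipCoef (f ω) := by
  have : SecondCountableTopology E := UniformSpace.secondCountable_of_separable E
  apply measurable_of_Iic
  intro K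
  by_cases hK : 0 ≤ K
  · have : (fun ω => lipCoef (f ω)) ⁻¹' Set.Iic K =
        ⋂ (m : ℕ) (n : ℕ), {ω | dist (f ω (TopologicalSpace.denseSeq E m))
          (f ω (TopologicalSpace.denseSeq E n)) ≤
          K * dist (TopologicalSpace.denseSeq E m) (TopologicalSpace.denseSeq E n)} := by
      ext ω
      simp only [Set.mem_preimage, Set.mem_Iic, Set.mem_iInter, Set.mem_ofPred_eq]
      constructor
      · intro h m n
        refine (dist_le_lipCoef (hf ω) _ _).trans ?_
        gcongr
      · intro h
        apply lipCoef_le hK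
        obtain ⟨K', hK'⟩ := hf ω
        have hc := hK'.continuous
        intro a b
        have hd := (TopologicalSpace.denseRange_denseSeq E).prodMap
          (TopologicalSpace.denseRange_denseSeq E)
        have hcl : IsClosed {p : E × E | dist (f ω p.1) (f ω p.2) ≤ K * dist p.1 p.2} :=
          isClosed_le (by fun_prop) (by fun_prop)
        exact hd.induction_on (p := fun p : E × E => dist (f ω p.1) (f ω p.2) ≤ K * dist p.1 p.2)
          (a, b) hcl (fun q => h q.1 q.2)
    rw [this]
    refine MeasurableSet.iInter fun m => MeasurableSet.iInter fun n => ?_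
    exact measurableSet_le ((hm _).dist (hm _)) measurable_const
  · have : (fun ω => lipCoef (f ω)) ⁻¹' Set.Iic K = ∅ := by
      ext ω
      simp only [Set.mem_preimage, Set.mem_Iic, Set.mem_empty_iff_false, iff_false]
      intro h
      exact hK ((lipCoef_nonneg _).trans h)
    rw [this]; exact MeasurableSet.empty

/-- forward composition `f_{j+n} ∘ ⋯ ∘ f_{j+1}` -/
def fcomp {E : Type*} (f : ℕ → E → E) (j : ℕ) : ℕ → E → E
  | 0 => fun z => z
  | n + 1 => fun z => f (j + n + 1) (fcomp f j n z)

lemma fcomp_succ' {E : Type*} (f : ℕ → E → E) (j n : ℕ) (z : E) :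
    fcomp f j (n+1) z = fcomp f (j+1) n (f (j+1) z) := by
  induction n with
  | zero => rfl
  | succ n ih =>
    show f (j + (n+1) + 1) (fcomp f j (n+1) z) = f (j + 1 + n + 1) (fcomp f (j+1) n (f (j+1) z))
    rw [ih]; congr 1; omega

lemma fcomp_lip {E : Type*} [PseudoMetricSpace E] (f : ℕ → E → E)
    (hf : ∀ t, ∃ K : NNReal, LipschitzWith K (f t)) (j n : ℕ) :
    ∃ K : NNReal, LipschitzWith K (fcomp f j n) := by
  induction n with
  | zero => exact ⟨1, LipschitzWith.id⟩
  | succ n ih =>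
    obtain ⟨K, hK⟩ := ih
    obtain ⟨K', hK'⟩ := hf (j+n+1)
    exact ⟨K' * K, hK'.comp hK⟩

lemma telescope {E : Type*} [PseudoMetricSpace E] (f : ℕ → E → E)
    (hf : ∀ t, ∃ K : NNReal, LipschitzWith K (f t)) (z : ℕ → E) (e : ℕ → ℝ)
    (he : ∀ t, dist (f (t+1) (z t)) (z (t+1)) ≤ e t) (t : ℕ) :
    dist (fcomp f 0 t (z 0)) (z t) ≤
      ∑ j ∈ Finset.range t, lipCoef (fcomp f (j+1) (t - (j+1))) * e j := by
  have h := dist_le_range_sum_dist (fun j => fcomp f j (t - j) (z j)) t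
  simp only [Nat.sub_zero, Nat.sub_self] at h
  refine (show dist (fcomp f 0 t (z 0)) (z t) ≤ _ from h).trans (Finset.sum_le_sum fun j hj => ?_)
  have hj' := Finset.mem_range.1 hj
  have e1 : t - j = (t - (j+1)) + 1 := by omega
  rw [e1, fcomp_succ']
  exact (dist_le_lipCoef (fcomp_lip f hf _ _) _ _).trans
    (mul_le_mul_of_nonneg_left (he j) (lipCoef_nonneg _))

lemma L_bound {E : Type*} [PseudoMetricSpace E] (f : ℕ → E → E)
    (hf : ∀ t, ∃ K : NNReal, LipschitzWith K (f t)) (h g : ℕ → ℝ) (r : ℕ) (hr : 1 ≤ r)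
    (ε M c : ℝ) (hε : 0 ≤ ε) (hM : 0 ≤ M) (hc : 0 ≤ c)
    (h1 : ∀ s, lipCoef (f s) ≤ Real.exp (h s)) (h2 : ∀ s : ℕ, h s ≤ ε * s + M)
    (hblk : ∀ j n, lipCoef (fcomp f j (n + r)) ≤
      Real.exp (g (j + (n + r))) * lipCoef (fcomp f j n))
    (hg : ∀ n : ℕ, |(∑ s ∈ Finset.range n, g s) + n * c| ≤ ε * n + M) (j n : ℕ) :
    lipCoef (fcomp f j n) ≤ Real.exp ((2 * r ^ 2 * M + c * r + 2 * M)
      + (2 * r ^ 2 + 2) * ε * (j + n) - c / r * n) := by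
  set b : ℝ := ε * (j + n) + M with hb
  have hb0 : 0 ≤ b := by positivity
  have hr' : (1 : ℝ) ≤ r := by exact_mod_cast hr
  have hL0 : lipCoef (fcomp f j 0) ≤ 1 := lipCoef_le zero_le_one (by intro a b; simp [fcomp])
  have hL1 : ∀ m < n, lipCoef (fcomp f j (m+1)) ≤ Real.exp b * lipCoef (fcomp f j m) := by
    intro m hm
    refine (lipCoef_comp_le (hf (j+m+1)) (fcomp_lip f hf j m)).trans ?_
    refine mul_le_mul_of_nonneg_right ((h1 _).trans (Real.exp_le_exp.2 ((h2 _).trans ?_)))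
      (lipCoef_nonneg _)
    rw [hb]
    have : ((j + m + 1 : ℕ) : ℝ) ≤ j + n := by exact_mod_cast (by omega : j + m + 1 ≤ j + n)
    gcongr
  rcases Nat.lt_or_ge n r with hn | hn
  · have hind : ∀ m ≤ n, lipCoef (fcomp f j m) ≤ Real.exp (m * b) := by
      intro m
      induction m with
      | zero => intro _; simpa using hL0
      | succ m ih =>
        intro hm
        refine (hL1 m (by omega)).trans ?_
        calc _ ≤ Real.exp b * Real.exp (m * b) := by gcongr; exact ih (by omega)
          _ = _ := by rw [← Real.exp_add]; push_cast; ring_nf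
    refine (hind n le_rfl).trans (Real.exp_le_exp.2 ?_)
    have hn' : (n : ℝ) ≤ r := by exact_mod_cast hn.le
    have e1 : n * b ≤ r * b := by gcongr
    have e2 : c / r * n ≤ c * r := by
      calc c / r * n ≤ c / r * r := by gcongr
        _ = c := by field_simp
        _ ≤ c * r := by nlinarith
    have e3 : r * b ≤ 2 * r ^ 2 * b := by
      gcongr; nlinarith
    have e4 : 2 * r^2 * b = 2 * r^2 * M + 2 * r^2 * ε * (j+n) := by rw [hb]; ring
    have e5 : 0 ≤ 2 * ε * (j + n : ℝ) := by positivity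
    nlinarith
  · obtain ⟨m, rfl⟩ : ∃ m, n = m + r := ⟨n - r, by omega⟩
    have hB := block_bound (fun i => lipCoef (fcomp f j i)) (fun i => g (j + i)) r (m+r) b hb0
      (fun i => lipCoef_nonneg _) hL0 hL1 (fun i _ => hblk j i) m rfl hr
    have hsum : ∑ k ∈ Finset.range m, g (j + (k + r)) =
        ∑ s ∈ Finset.range (j + r + m), g s - ∑ s ∈ Finset.range (j + r), g s := by
      rw [Finset.sum_range_add, add_sub_cancel_left]
      exact Finset.sum_congr rfl fun k _ => by congr 1; ring
    simp only [hsum] at hB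
    have g1 := (abs_le.1 (hg (j + r + m))).2
    have g2 := (abs_le.1 (hg (j + r))).1
    push_cast at g1 g2
    set X : ℝ := 2 * r^2 * b + c * r + 2 * ε * (j + (m + r : ℕ)) + 2 * M with hX
    have hX0 : 0 ≤ X := by positivity
    have hB2 : lipCoef (fcomp f j (m+r)) ^ r ≤ (Real.exp ((X - c * (m + r : ℕ)) / r)) ^ r := by
      rw [← Real.exp_nat_mul]
      refine hB.trans (Real.exp_le_exp.2 ?_)
      have : (r : ℝ) * ((X - c * (m + r : ℕ)) / r) = X - c * (m + r : ℕ) := by field_simp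
      rw [this, hX]
      push_cast
      have : 0 ≤ ε * m := by positivity
      nlinarith
    have hB3 := le_of_pow_le_pow_left₀ (by omega) (Real.exp_pos _).le hB2
    refine hB3.trans (Real.exp_le_exp.2 ?_)
    have : X / r ≤ X := div_le_self hX0 hr'
    rw [sub_div]
    have e4 : X = 2 * r ^ 2 * M + c * r + 2 * M + (2 * r ^ 2 + 2) * ε * (j + (m + r : ℕ)) := by
      rw [hX, hb]; ring
    rw [← e4]
    have e5 : c * (m + r : ℕ) / r = c / r * (m + r : ℕ) := by ring
    rw [e5]; linarith

lemma iterComp_shift {Ω E : Type*} (T : Ω → Ω) (Φ : ℤ → Ω → E → E)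
    (hs : ∀ t ω, Φ (t + 1) ω = Φ t (T ω)) (n : ℕ) (a : ℤ) (ω : Ω) :
    Φ (a + n) ω = Φ a (T^[n] ω) := by
  induction n generalizing ω with
  | zero => simp
  | succ n ih =>
    rw [Function.iterate_succ_apply, ← ih, ← hs]
    congr 1; push_cast; ring

lemma iterComp_shift' {Ω E : Type*} (T : Ω → Ω) (Φ : ℤ → Ω → E → E)
    (hs : ∀ t ω, Φ (t + 1) ω = Φ t (T ω)) (n m : ℕ) (ω : Ω) :
    iterComp Φ (n : ℤ) m ω = iterComp Φ 0 m (T^[n] ω) := by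
  induction m with
  | zero =>
    show Φ (n : ℤ) ω = Φ 0 (T^[n] ω)
    rw [← iterComp_shift T Φ hs n 0]; simp
  | succ m ih =>
    funext y
    show iterComp Φ (n : ℤ) m ω (Φ (n - (m + 1 : ℕ)) ω y) =
      iterComp Φ 0 m (T^[n] ω) (Φ (0 - (m + 1 : ℕ)) (T^[n] ω) y)
    rw [ih, ← iterComp_shift T Φ hs n]
    congr 3

lemma fcomp_iterComp {Ω E : Type*} (Φ : ℤ → Ω → E → E) (ω : Ω) (j m : ℕ) : ∀ (n : ℕ) (z : E),
    fcomp (fun t => Φ t ω) j (n + (m + 1)) z =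
      iterComp Φ ((j + (n + (m + 1)) : ℕ) : ℤ) m ω (fcomp (fun t => Φ t ω) j n z) := by
  induction m with
  | zero => intro n z; rfl
  | succ m ih =>
    intro n z
    have e : n + (m + 1 + 1) = (n + 1) + (m + 1) := by ring
    rw [e, ih (n+1) z]
    show _ = iterComp Φ _ m ω (Φ (((j + (n + 1 + (m + 1)) : ℕ) : ℤ) - (m + 1 : ℕ)) ω _)
    congr 1
    show Φ ((j + n + 1 : ℕ) : ℤ) ω _ = _
    congr 1; push_cast; ring_nf

lemma iterComp_lip {Ω E : Type*} [PseudoMetricSpace E] (Φ : ℤ → Ω → E → E)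
    (hf : ∀ t ω, ∃ K : NNReal, LipschitzWith K (Φ t ω)) (t : ℤ) (m : ℕ) (ω : Ω) :
    ∃ K : NNReal, LipschitzWith K (iterComp Φ t m ω) := by
  induction m with
  | zero => exact hf t ω
  | succ m ih =>
    obtain ⟨K, hK⟩ := ih
    obtain ⟨K', hK'⟩ := hf (t - (m + 1 : ℕ)) ω
    exact ⟨K * K', hK.comp hK'⟩

lemma bound_of_tendsto (u : ℕ → ℝ) (hu : ∀ t, 0 ≤ u t) (C κ : ℝ) (hκ : κ ≤ C)
    (h : Tendsto (fun t : ℕ => Real.exp (C * t) * u t) atTop (𝓝 0)) :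
    ∃ B, 0 ≤ B ∧ ∀ t : ℕ, u t ≤ B * Real.exp (-κ * t) := by
  obtain ⟨B, hB⟩ := h.bddAbove_range
  have hB' : ∀ t : ℕ, Real.exp (C * t) * u t ≤ B := fun t => hB ⟨t, rfl⟩
  refine ⟨B, (mul_nonneg (Real.exp_pos _).le (hu 0)).trans (hB' 0), fun t => ?_⟩
  have h0 : 0 ≤ B := (mul_nonneg (Real.exp_pos _).le (hu 0)).trans (hB' 0)
  calc u t = Real.exp (-C * t) * (Real.exp (C * t) * u t) := by
        rw [← mul_assoc, ← Real.exp_add]; simp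
    _ ≤ Real.exp (-C * t) * B := by gcongr; exact hB' t
    _ ≤ Real.exp (-κ * t) * B := by gcongr
    _ = _ := mul_comm _ _

lemma path_bound {E : Type*} [NormedAddCommGroup E] (f fh : ℕ → E → E)
    (hf : ∀ t, ∃ K : NNReal, LipschitzWith K (f t))
    (hfh : ∀ t, ∃ K : NNReal, LipschitzWith K (fh t)) (x : E) (y yh : ℕ → E)
    (hy : ∀ t, y (t+1) = f (t+1) (y t)) (hyh : ∀ t, yh (t+1) = fh (t+1) (yh t))
    (ε κ M₀ M₁ B₁ B₂ : ℝ) (hε : 0 < ε) (hκ : ε < κ) (hB₁ : 0 ≤ B₁) (hB₂ : 0 ≤ B₂)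
    (hL : ∀ j n : ℕ, lipCoef (fcomp f j n) ≤ Real.exp (M₀ + ε * (j + n) - κ * n))
    (hp : ∀ s : ℕ, ‖f s x - x‖ ≤ Real.exp (ε * s + M₁))
    (hd : ∀ t : ℕ, ‖fh t x - f t x‖ ≤ B₁ * Real.exp (-κ * t))
    (hw : ∀ t : ℕ, lipCoef (fun z => fh t z - f t z) ≤ B₂ * Real.exp (-κ * t)) :
    ∃ K', ∀ t : ℕ, ‖yh t - y t‖ ≤ K' * Real.exp (-κ * t + 5 * ε * t) := by
  have hκ0 : 0 < κ := hε.trans hκ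
  have hdl : ∀ t, ∃ K : NNReal, LipschitzWith K (fun z => fh t z - f t z) := by
    intro t
    obtain ⟨K, hK⟩ := hf t
    obtain ⟨K', hK'⟩ := hfh t
    exact ⟨K' + K, hK'.sub hK⟩
  set d : ℕ → ℝ := fun j => ‖fh (j+1) x - f (j+1) x‖ with hdd
  set w : ℕ → ℝ := fun j => lipCoef (fun z => fh (j+1) z - f (j+1) z) with hww
  set A : ℕ → ℝ := fun t => ‖yh t - x‖ with hAA
  have hd0 : ∀ j, 0 ≤ d j := fun j => norm_nonneg _
  have hw0 : ∀ j, 0 ≤ w j := fun j => lipCoef_nonneg _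
  have hA0 : ∀ j, 0 ≤ A j := fun j => norm_nonneg _
  have hd' : ∀ j : ℕ, d j ≤ B₁ * Real.exp (-κ * j) := by
    intro j
    refine (hd (j+1)).trans ?_
    gcongr ?_ * Real.exp ?_
    push_cast; nlinarith
  have hw' : ∀ j : ℕ, w j ≤ B₂ * Real.exp (-κ * j) := by
    intro j
    refine (hw (j+1)).trans ?_
    gcongr ?_ * Real.exp ?_
    push_cast; nlinarith
  have herr : ∀ t, dist (f (t+1) (yh t)) (yh (t+1)) ≤ d t + w t * A t := by
    intro t
    rw [hyh, dist_comm, dist_eq_norm]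
    have h1 := dist_le_lipCoef (hdl (t+1)) (yh t) x
    rw [dist_eq_norm, dist_eq_norm] at h1
    calc ‖fh (t+1) (yh t) - f (t+1) (yh t)‖
        = ‖(fh (t+1) x - f (t+1) x) +
          ((fh (t+1) (yh t) - f (t+1) (yh t)) - (fh (t+1) x - f (t+1) x))‖ := by
          congr 1; abel
      _ ≤ _ := (norm_add_le _ _).trans (by gcongr)
  have htel1 := telescope f hf yh _ herr
  have htelx := telescope f hf (fun _ => x) (fun t => ‖f (t+1) x - x‖)
    (fun t => by rw [dist_eq_norm])
  have htely := telescope f hf y (fun _ => 0) (fun t => by rw [hy]; simp)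
  have hLt : ∀ t j : ℕ, j < t → lipCoef (fcomp f (j+1) (t - (j+1))) ≤
      Real.exp M₀ * Real.exp (ε * t) * Real.exp (-κ * (t - (j + 1))) := by
    intro t j hj
    refine (hL _ _).trans (le_of_eq ?_)
    rw [← Real.exp_add, ← Real.exp_add, Nat.cast_sub (by omega)]
    congr 1; push_cast; ring
  have hLt0 : ∀ t : ℕ, lipCoef (fcomp f 0 t) ≤
      Real.exp M₀ * Real.exp (ε * t) * Real.exp (-κ * t) := by
    intro t
    refine (hL _ _).trans (le_of_eq ?_)
    rw [← Real.exp_add, ← Real.exp_add]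
    congr 1; push_cast; ring
  have hLt' : ∀ t j : ℕ, j < t → lipCoef (fcomp f (j+1) (t - (j+1))) ≤
      Real.exp M₀ * Real.exp (ε * t) := by
    intro t j hj
    refine (hLt t j hj).trans (mul_le_of_le_one_right (by positivity) ?_)
    rw [Real.exp_le_one_iff]
    have : ((j + 1 : ℕ) : ℝ) ≤ t := by exact_mod_cast hj
    push_cast at this
    nlinarith
  have hLt0' : ∀ t : ℕ, lipCoef (fcomp f 0 t) ≤ Real.exp M₀ * Real.exp (ε * t) := by
    intro t
    refine (hLt0 t).trans (mul_le_of_le_one_right (by positivity) ?_)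
    rw [Real.exp_le_one_iff]
    have : (0:ℝ) ≤ t := by positivity
    nlinarith
  -- step one
  set M := Real.exp M₀ + (Real.exp (ε + M₁) + B₁) + B₂ with hMdef
  have hM : 0 ≤ M := by positivity
  obtain ⟨K, hK0, hK⟩ := step_one A (fun j => ‖f (j+1) x - x‖ + d j) w M ε κ hε hκ hM hA0
    (fun j => add_nonneg (norm_nonneg _) (hd0 j)) hw0
    (by
      intro n
      have e1 : ‖f (n+1) x - x‖ ≤ Real.exp (ε + M₁) * Real.exp (ε * n) := by
        refine (hp (n+1)).trans (le_of_eq ?_)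
        rw [← Real.exp_add]; congr 1; push_cast; ring
      have e2 : d n ≤ B₁ * Real.exp (ε * n) := by
        refine (hd' n).trans ?_
        gcongr ?_ * Real.exp ?_
        have : (0:ℝ) ≤ n := by positivity
        nlinarith
      calc _ ≤ (Real.exp (ε + M₁) + B₁) * Real.exp (ε * n) := by rw [add_mul]; gcongr
        _ ≤ M * Real.exp (ε * n) := by
          gcongr; rw [hMdef]; linarith [Real.exp_pos M₀])
    (by
      intro n
      refine (hw' n).trans ?_
      gcongr
      rw [hMdef]; linarith [Real.exp_pos M₀, Real.exp_pos (ε + M₁)])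
    (by
      intro t
      have t1 : A t ≤ dist (fcomp f 0 t (yh 0)) (yh t) +
          dist (fcomp f 0 t (yh 0)) (fcomp f 0 t x) + dist (fcomp f 0 t x) x := by
        show ‖yh t - x‖ ≤ _
        rw [← dist_eq_norm, dist_comm (fcomp f 0 t (yh 0)) (yh t)]
        exact dist_triangle4 _ _ _ _
      have t2 : dist (fcomp f 0 t (yh 0)) (fcomp f 0 t x) ≤ lipCoef (fcomp f 0 t) * A 0 := by
        have := dist_le_lipCoef (fcomp_lip f hf 0 t) (yh 0) x
        rwa [dist_eq_norm (yh 0)] at this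
      have t3 := htelx t
      have t4 : ∑ j ∈ Finset.range t, lipCoef (fcomp f (j+1) (t - (j+1))) * (d j + w j * A j)
          + ∑ j ∈ Finset.range t, lipCoef (fcomp f (j+1) (t - (j+1))) * ‖f (j+1) x - x‖
          ≤ Real.exp M₀ * Real.exp (ε * t) *
            ∑ j ∈ Finset.range t, (‖f (j+1) x - x‖ + d j + w j * A j) := by
        rw [← Finset.sum_add_distrib, Finset.mul_sum]
        apply Finset.sum_le_sum
        intro j hj
        have := hLt' t j (Finset.mem_range.1 hj)
        rw [← mul_add]
        have e0 : d j + w j * A j + ‖f (j+1) x - x‖ = ‖f (j+1) x - x‖ + d j + w j * A j := by ring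
        rw [e0]
        have := hd0 j
        have := mul_nonneg (hw0 j) (hA0 j)
        gcongr
      have t5 : lipCoef (fcomp f 0 t) * A 0 ≤ Real.exp M₀ * Real.exp (ε * t) * A 0 := by
        have := hA0 0
        gcongr
        exact hLt0' t
      have t6 : 0 ≤ A 0 + ∑ j ∈ Finset.range t, (‖f (j+1) x - x‖ + d j + w j * A j) :=
        add_nonneg (hA0 0) (Finset.sum_nonneg fun j _ =>
          add_nonneg (add_nonneg (norm_nonneg _) (hd0 j)) (mul_nonneg (hw0 j) (hA0 j)))
      calc A t ≤ Real.exp M₀ * Real.exp (ε * t) *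
          (A 0 + ∑ j ∈ Finset.range t, (‖f (j+1) x - x‖ + d j + w j * A j)) := by
            rw [mul_add]; linarith [htel1 t]
        _ ≤ M * Real.exp (ε * t) *
          (A 0 + ∑ j ∈ Finset.range t, (‖f (j+1) x - x‖ + d j + w j * A j)) := by
            gcongr; rw [hMdef]; linarith [Real.exp_pos (ε + M₁)])
  -- step two
  apply step_two (fun t => ‖yh t - y t‖) (fun j => d j + w j * A j) (Real.exp M₀) (B₁ + B₂ * K)
    ε κ hε (Real.exp_pos _).le (by positivity) (norm_nonneg _)
  · intro n
    calc d n + w n * A n ≤ B₁ * Real.exp (-κ * n) +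
          (B₂ * Real.exp (-κ * n)) * (K * Real.exp (3 * ε * n)) := by
          have := hA0 n
          have := hw' n
          have := hd' n
          have := hK n
          gcongr
      _ = B₁ * Real.exp (-κ * n) + B₂ * K * (Real.exp (-κ * n) * Real.exp (3 * ε * n)) := by ring
      _ ≤ B₁ * Real.exp (-κ * n + 3 * ε * n) + B₂ * K * Real.exp (-κ * n + 3 * ε * n) := by
          rw [← Real.exp_add]
          gcongr ?_ * Real.exp ?_ + _
          have : 0 ≤ 3 * ε * n := by positivity
          linarith
      _ = _ := by ring
  · intro t
    have y0 : fcomp f 0 t (y 0) = y t := by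
      have := htely t
      simp only [mul_zero, Finset.sum_const_zero] at this
      exact dist_le_zero.1 this
    have t1 : ‖yh t - y t‖ ≤ dist (fcomp f 0 t (yh 0)) (yh t) +
        dist (fcomp f 0 t (yh 0)) (fcomp f 0 t (y 0)) := by
      rw [y0, ← dist_eq_norm, dist_comm (fcomp f 0 t (yh 0)) (yh t)]
      exact dist_triangle _ _ _
    have t2 : dist (fcomp f 0 t (yh 0)) (fcomp f 0 t (y 0)) ≤
        Real.exp M₀ * Real.exp (ε * t) * (Real.exp (-κ * t) * ‖yh 0 - y 0‖) := by
      refine (dist_le_lipCoef (fcomp_lip f hf 0 t) (yh 0) (y 0)).trans ?_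
      rw [dist_eq_norm, ← mul_assoc]
      gcongr
      exact hLt0 t
    have t3 : ∑ j ∈ Finset.range t, lipCoef (fcomp f (j+1) (t - (j+1))) * (d j + w j * A j) ≤
        Real.exp M₀ * Real.exp (ε * t) *
        ∑ j ∈ Finset.range t, Real.exp (-κ * (t - (j + 1))) * (d j + w j * A j) := by
      rw [Finset.mul_sum]
      apply Finset.sum_le_sum
      intro j hj
      rw [← mul_assoc]
      have := hd0 j
      have := mul_nonneg (hw0 j) (hA0 j)
      gcongr
      exact hLt t j (Finset.mem_range.1 hj)
    rw [mul_add]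
    linarith [htel1 t]

lemma le_exp_logPlus {a : ℝ} (ha : 0 ≤ a) : a ≤ Real.exp (logPlus a) := by
  rcases ha.eq_or_lt with h | h
  · rw [← h]; exact (Real.exp_pos _).le
  · calc a = Real.exp (Real.log a) := (Real.exp_log h).symm
      _ ≤ _ := Real.exp_le_exp.2 (le_max_left _ _)

lemma integrable_logPlus {Ω : Type*} [MeasurableSpace Ω] {μ : Measure Ω} {u : Ω → ℝ}
    (hu : Measurable u) (h : ∫⁻ ω, ENNReal.ofReal (logPlus (u ω)) ∂μ < ⊤) :
    Integrable (fun ω => logPlus (u ω)) μ := by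
  have hm : Measurable fun ω => logPlus (u ω) := (Real.measurable_log.comp hu).max measurable_const
  refine ⟨hm.aestronglyMeasurable, ?_⟩
  have h0 : ∀ ω, 0 ≤ logPlus (u ω) := fun ω => le_max_right _ _
  rw [hasFiniteIntegral_iff_ofReal (ae_of_all _ h0)]
  exact h

/-- perturbed SRE, Straumann–Mikosch Theorem 2.10: on a separable Banach
space, if the stationary ergodic Lipschitz SRE `(Φ_t)` satisfies the Bougerol
conditions, `(Y_t)` is its stationary solution with `E[log⁺‖Y₀‖] < ∞`, and
`(Φ̂_t)_{t≥1}` are perturbed maps with `‖Φ̂_t(x) − Φ_t(x)‖ → 0` e.a.s. and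
`Λ(Φ̂_t − Φ_t) → 0` e.a.s., then any forward solution `Ŷ_t = Φ̂_t(Ŷ_{t−1})` with
arbitrary initial value satisfies `‖Ŷ_t − Y_t‖ → 0` e.a.s. -/
theorem perturbed_sre_eas
    {Ω E : Type*} [MeasurableSpace Ω]
    [NormedAddCommGroup E] [NormedSpace ℝ E] [CompleteSpace E]
    [TopologicalSpace.SeparableSpace E] [MeasurableSpace E] [BorelSpace E]
    (μ : Measure Ω) [IsProbabilityMeasure μ]
    (T : Ω ≃ᵐ Ω) (hT : Ergodic T μ)
    (Φ : ℤ → Ω → E → E)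
    (hstat : ∀ t ω, Φ (t + 1) ω = Φ t (T ω))
    (hmeas : ∀ t x, Measurable fun ω => Φ t ω x)
    (hlip : ∀ t ω, ∃ K : NNReal, LipschitzWith K (Φ t ω))
    (x : E)
    (hlog0 : ∫⁻ ω, ENNReal.ofReal (logPlus ‖Φ 0 ω x - x‖) ∂μ < ⊤)
    (hloglip : ∫⁻ ω, ENNReal.ofReal (logPlus (lipCoef (Φ 0 ω))) ∂μ < ⊤)
    (r : ℕ) (hr : 1 ≤ r)
    (hlyap : ∃ K : ℝ,
      ∫ ω, max (Real.log (lipCoef (iterComp Φ 0 (r - 1) ω))) (-K) ∂μ < 0)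
    -- the stationary solution, with logarithmic moments
    (Y : ℤ → Ω → E)
    (hYsol : ∀ᵐ ω ∂μ, ∀ t : ℤ, Y t ω = Φ t ω (Y (t - 1) ω))
    (hYstat : ∀ t ω, Y (t + 1) ω = Y t (T ω))
    (hYlog : ∫⁻ ω, ENNReal.ofReal (logPlus ‖Y 0 ω‖) ∂μ < ⊤)
    -- the perturbed maps
    (Φhat : ℕ → Ω → E → E)
    (hhatlip : ∀ t ω, ∃ K : NNReal, LipschitzWith K (Φhat t ω))
    (hpert0 : EasTendstoZero μ fun t ω => ‖Φhat t ω x - Φ (t : ℤ) ω x‖)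
    (hpertLip : EasTendstoZero μ fun t ω =>
      lipCoef fun z => Φhat t ω z - Φ (t : ℤ) ω z) :
    ∀ Yhat : ℕ → Ω → E,
      (∀ ω, ∀ t : ℕ, 0 < t → Yhat t ω = Φhat t ω (Yhat (t - 1) ω)) →
      EasTendstoZero μ fun t ω => ‖Yhat t ω - Y (t : ℤ) ω‖ := by
  have : SecondCountableTopology E := UniformSpace.secondCountable_of_separable E
  intro Yhat hYhat
  obtain ⟨C₁, hC₁, hpert0⟩ := hpert0
  obtain ⟨C₂, hC₂, hpertLip⟩ := hpertLip
  obtain ⟨K₀, hlyap⟩ := hlyap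
  set g : Ω → ℝ := fun ω => max (Real.log (lipCoef (iterComp Φ 0 (r - 1) ω))) (-K₀) with hg
  have hgi : Integrable g μ := by
    by_contra hc
    rw [integral_undef hc] at hlyap
    exact lt_irrefl _ hlyap
  have hle_g : ∀ ω, lipCoef (iterComp Φ 0 (r - 1) ω) ≤ Real.exp (g ω) := by
    intro ω
    rcases (lipCoef_nonneg (iterComp Φ 0 (r - 1) ω)).eq_or_lt with h | h
    · rw [← h]; exact (Real.exp_pos _).le
    · calc _ = Real.exp (Real.log (lipCoef (iterComp Φ 0 (r - 1) ω))) := (Real.exp_log h).symm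
        _ ≤ _ := Real.exp_le_exp.2 (le_max_left _ _)
  set c : ℝ := -∫ ω, g ω ∂μ with hc
  have hc0 : 0 < c := by rw [hc]; linarith
  have hr' : (1 : ℝ) ≤ r := by exact_mod_cast hr
  set κ : ℝ := min (c / r) (min C₁ C₂) with hκ
  have hκ0 : 0 < κ := lt_min (by positivity) (lt_min hC₁ hC₂)
  have hκc : κ ≤ c / r := min_le_left _ _
  have hκ1 : κ ≤ C₁ := (min_le_right _ _).trans (min_le_left _ _)
  have hκ2 : κ ≤ C₂ := (min_le_right _ _).trans (min_le_right _ _)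
  set ε : ℝ := κ / 10 with hε
  have hε0 : 0 < ε := by positivity
  set ε' : ℝ := ε / (2 * r ^ 2 + 2) with hε'
  have hε'0 : 0 < ε' := by positivity
  have hεε : (2 * r ^ 2 + 2) * ε' = ε := by rw [hε']; field_simp
  have hhi := integrable_logPlus (lipCoef_measurable (Φ 0) (hmeas 0) (hlip 0)) hloglip
  have hpi := integrable_logPlus (u := fun ω => ‖Φ 0 ω x - x‖)
    (((hmeas 0 x).sub measurable_const).norm) hlog0
  refine ⟨κ / 4, by positivity, ?_⟩
  filter_upwards [birk_bound hT hgi ε' hε'0, growth_bound hT hhi ε' hε'0,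
    growth_bound hT hpi ε hε0, hYsol, hpert0, hpertLip] with ω hb hh hp hY h0 h1
  obtain ⟨Mb, hb⟩ := hb
  obtain ⟨Mh, hh⟩ := hh
  obtain ⟨Mp, hp⟩ := hp
  obtain ⟨B₁, hB₁, hd⟩ := bound_of_tendsto _ (fun t => norm_nonneg _) C₁ κ hκ1 h0
  obtain ⟨B₂, hB₂, hw⟩ := bound_of_tendsto _ (fun t => lipCoef_nonneg _) C₂ κ hκ2 h1
  have hsh : ∀ n : ℕ, Φ (n : ℤ) ω = Φ 0 (T^[n] ω) := by
    intro n
    rw [← iterComp_shift T Φ hstat n 0]; simp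
  set M : ℝ := max 0 (max Mb Mh) with hM
  have hM0 : 0 ≤ M := le_max_left _ _
  have hMb : Mb ≤ M := (le_max_left _ _).trans (le_max_right _ _)
  have hMh : Mh ≤ M := (le_max_right _ _).trans (le_max_right _ _)
  have hLb := L_bound (fun t : ℕ => Φ (t : ℤ) ω) (fun t => hlip _ _)
    (fun s => logPlus (lipCoef (Φ 0 (T^[s] ω)))) (fun s => g (T^[s] ω)) r hr ε' M c hε'0.le hM0
    hc0.le
    (fun s => by
      rw [hsh]; exact le_exp_logPlus (lipCoef_nonneg _))
    (fun s => (hh s).trans (by linarith))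
    (by
      intro j n
      obtain ⟨m, rfl⟩ : ∃ m, r = m + 1 := ⟨r - 1, by omega⟩
      have e : fcomp (fun t : ℕ => Φ (t : ℤ) ω) j (n + (m + 1)) = fun z =>
          iterComp Φ 0 m (T^[j + (n + (m + 1))] ω) (fcomp (fun t : ℕ => Φ (t : ℤ) ω) j n z) := by
        funext z
        rw [fcomp_iterComp, iterComp_shift' T Φ hstat]
      rw [e]
      refine (lipCoef_comp_le (iterComp_lip Φ hlip _ _ _)
        (fcomp_lip _ (fun t => hlip _ _) _ _)).trans ?_
      exact mul_le_mul_of_nonneg_right (hle_g _) (lipCoef_nonneg _))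
    (by
      intro n
      have := hb n
      rw [show (∑ s ∈ Finset.range n, g (T^[s] ω)) + n * c =
        (∑ s ∈ Finset.range n, g (T^[s] ω)) - n * ∫ ω, g ω ∂μ by rw [hc]; ring]
      linarith)
  obtain ⟨K', hK'⟩ := path_bound (fun t : ℕ => Φ (t : ℤ) ω) (fun t => Φhat t ω)
    (fun t => hlip _ _) (fun t => hhatlip _ _) x (fun t => Y (t : ℤ) ω) (fun t => Yhat t ω)
    (fun t => by
      have := hY ((t + 1 : ℕ) : ℤ)
      rw [this]; congr 2; push_cast; ring)
    (fun t => hYhat ω (t+1) (Nat.succ_pos t))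
    ε κ (2 * r ^ 2 * M + c * r + 2 * M) Mp B₁ B₂ hε0 (by rw [hε]; linarith) hB₁ hB₂
    (by
      intro j n
      refine (hLb j n).trans (Real.exp_le_exp.2 ?_)
      rw [hεε]
      have : κ * n ≤ c / r * n := by gcongr
      linarith)
    (by
      intro s
      rw [hsh]
      exact (le_exp_logPlus (norm_nonneg _)).trans (Real.exp_le_exp.2 (hp s)))
    hd hw
  have hlim : Tendsto (fun t : ℕ => K' * Real.exp (-(κ / 4)) ^ t) atTop (𝓝 0) := by
    have := (tendsto_pow_atTop_nhds_zero_of_lt_one (Real.exp_pos (-(κ/4))).le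
      (by rw [Real.exp_lt_one_iff]; linarith)).const_mul K'
    simpa using this
  refine squeeze_zero (fun t => mul_nonneg (Real.exp_pos _).le (norm_nonneg _)) (fun t => ?_) hlim
  calc _ ≤ Real.exp (κ / 4 * t) * (K' * Real.exp (-κ * t + 5 * ε * t)) := by
        gcongr; exact hK' t
    _ = K' * (Real.exp (κ / 4 * t) * Real.exp (-κ * t + 5 * ε * t)) := by ring
    _ = _ := by
        rw [← Real.exp_add, ← Real.exp_nat_mul, hε]; congr 2; ring
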